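/- arXiv:math/0004080 — 5 statements merged into one kernel-verified Lean document; each statement's English description precedes it below -/
import Mathlib

section
/- Let G be a finite simple graph on a finite vertex type V and let A, B be distinct vertices of G. Then the adjacency matrix of G over the field ℤ/2ℤ is congruent (as a symmetric bilinear form over ℤ/2ℤ, i.e. N = PᵀMP for some invertible matrix P) to the adjacency matrix of G̃_{AB}, and the adjacency matrix of G'_{AB} is congruent to the adjacency matrix of G̃'_{AB}. -/
open Matrix

/-- The graph obtained from `G` by toggling (adding if absent, deleting if present)
the edge `{A, B}`. -/
def toggleEdge {V : Type*} (G : SimpleGraph V) (A B : V) : SimpleGraph V :=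
  SimpleGraph.fromEdgeSet (symmDiff G.edgeSet {s(A, B)})

/-- The graph `G̃_{AB}`: toggle the edge `{A, C}` for every vertex `C ∉ {A, B}`
that is adjacent to `B` in `G`; all other adjacencies are unchanged. -/
def gTilde {V : Type*} (G : SimpleGraph V) (A B : V) : SimpleGraph V :=
  SimpleGraph.fromEdgeSet (symmDiff G.edgeSet
    {e | ∃ C, C ≠ A ∧ C ≠ B ∧ G.Adj B C ∧ e = s(A, C)})

open Classical in
/-- The adjacency matrix of a simple graph over the field `ℤ/2ℤ`. -/
noncomputable def adjMat {V : Type*} (G : SimpleGraph V) : Matrix V V (ZMod 2) :=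
  Matrix.of fun i j => if G.Adj i j then 1 else 0

theorem toggleEdge_adj {V : Type*} (G : SimpleGraph V) (A B x y : V) :
    (toggleEdge G A B).Adj x y ↔
      x ≠ y ∧ Xor (G.Adj x y) ((x = A ∧ y = B) ∨ (x = B ∧ y = A)) := by
  simp only [toggleEdge, SimpleGraph.fromEdgeSet_adj, Set.mem_symmDiff, SimpleGraph.mem_edgeSet,
    Set.mem_singleton_iff, Sym2.eq_iff, Xor]
  exact and_comm

theorem gTilde_adj {V : Type*} (G : SimpleGraph V) (A B x y : V) :
    (gTilde G A B).Adj x y ↔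
      x ≠ y ∧ Xor (G.Adj x y)
        ((x = A ∧ y ≠ A ∧ y ≠ B ∧ G.Adj B y) ∨ (y = A ∧ x ≠ A ∧ x ≠ B ∧ G.Adj B x)) := by
  have h : (∃ C, C ≠ A ∧ C ≠ B ∧ G.Adj B C ∧ s(x, y) = s(A, C)) ↔
      ((x = A ∧ y ≠ A ∧ y ≠ B ∧ G.Adj B y) ∨ (y = A ∧ x ≠ A ∧ x ≠ B ∧ G.Adj B x)) := by
    constructor
    · rintro ⟨C, hA, hB, hC, he⟩
      rcases Sym2.eq_iff.mp he with ⟨rfl, rfl⟩ | ⟨rfl, rfl⟩ <;> simp [*]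
    · rintro (⟨rfl, h⟩ | ⟨rfl, h⟩)
      · exact ⟨y, h.1, h.2.1, h.2.2, rfl⟩
      · exact ⟨x, h.1, h.2.1, h.2.2, Sym2.eq_swap⟩
  simp only [gTilde, SimpleGraph.fromEdgeSet_adj, Set.mem_symmDiff, SimpleGraph.mem_edgeSet,
    Set.mem_ofPred_eq, h, Xor]
  exact and_comm

theorem toggleEdge_gTilde {V : Type*} (G : SimpleGraph V) (A B : V) :
    toggleEdge (gTilde G A B) A B = gTilde (toggleEdge G A B) A B := by
  have hxor (p q r : Prop) : Xor (Xor p q) r ↔ Xor (Xor p r) q := by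
    by_cases p <;> by_cases q <;> by_cases r <;> simp [Xor, *]
  have hB (C : V) : (C ≠ A ∧ C ≠ B ∧ (toggleEdge G A B).Adj B C) ↔
      (C ≠ A ∧ C ≠ B ∧ G.Adj B C) :=
    and_congr_right fun hCA => and_congr_right fun hCB => by
      simp [toggleEdge_adj, hCA, hCB, hCB.symm, Xor]
  ext x y
  rw [gTilde_adj, hB, hB, toggleEdge_adj, toggleEdge_adj, gTilde_adj]
  refine and_congr_right fun hxy => ?_
  simp only [hxy, ne_eq, not_false_eq_true, true_and]
  exact hxor _ _ _

theorem isUnit_transvection {n R : Type*} [Fintype n] [DecidableEq n] [CommRing R]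
    {i j : n} (h : i ≠ j) (c : R) : IsUnit (transvection i j c) := by
  simp [Matrix.isUnit_iff_isUnit_det, det_transvection_of_ne i j h]

/-- Adding row and column `B` to row and column `A` realizes `G ↦ G̃_{AB}`. -/
theorem adjMat_gTilde {V : Type*} [Fintype V] [DecidableEq V]
    (G : SimpleGraph V) {A B : V} (hAB : A ≠ B) :
    adjMat (gTilde G A B) = (transvection B A 1)ᵀ * adjMat G * transvection B A 1 := by
  have ht : (transvection B A (1 : ZMod 2))ᵀ = transvection A B 1 := by
    simp [transvection]
  have two : (1 : ZMod 2) + 1 = 0 := by decide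
  rw [ht]
  ext i j
  by_cases hne : i = j
  · subst hne
    by_cases hi : i = A <;> by_cases hB : G.Adj A B <;>
      simp_all [adjMat, G.adj_comm]
  by_cases hi : i = A <;> by_cases hj : j = A <;> by_cases hij : G.Adj i j <;>
    by_cases hBi : G.Adj B i <;> by_cases hBj : G.Adj B j <;>
    by_cases hiB : i = B <;> by_cases hjB : j = B <;>
    simp_all [adjMat, gTilde_adj, Xor, G.adj_comm]

/-- The adjacency matrix of `G` over `ℤ/2ℤ` is congruent (as a symmetric bilinear
form) to the adjacency matrix of `G̃_{AB}`, and the adjacency matrix of `G'_{AB}`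
is congruent to the adjacency matrix of `G̃'_{AB}`. -/
theorem adjMat_congruent_two_term {V : Type*} [Fintype V] [DecidableEq V]
    (G : SimpleGraph V) (A B : V) (hAB : A ≠ B) :
    (∃ P : Matrix V V (ZMod 2), IsUnit P ∧
      adjMat (gTilde G A B) = Pᵀ * adjMat G * P) ∧
    (∃ P : Matrix V V (ZMod 2), IsUnit P ∧
      adjMat (toggleEdge (gTilde G A B) A B) = Pᵀ * adjMat (toggleEdge G A B) * P) := by
  refine ⟨⟨transvection B A 1, isUnit_transvection hAB.symm 1, adjMat_gTilde G hAB⟩,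
    ⟨transvection B A 1, isUnit_transvection hAB.symm 1, ?_⟩⟩
  rw [toggleEdge_gTilde]
  exact adjMat_gTilde _ hAB
end

section
/- Let G be a finite simple graph on a finite vertex set V with n = |V|, and suppose G has an isolated vertex. Then the polynomial R̂(G)(X) = Σ_{J ⊆ V} (−1)^{n−|J|} X^{rank(G_J)} is the zero polynomial in ℤ[X], where for J ⊆ V, G_J is the induced subgraph of G on J and rank(G_J) is the rank over ℤ/2ℤ of its adjacency matrix. -/
open Matrix Polynomial

open Classical in
/-- The adjacency matrix over `ℤ/2ℤ` of the induced subgraph of `G` on the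
vertex subset `J`. -/
noncomputable def inducedAdj {V : Type*} (G : SimpleGraph V) (J : Finset V) :
    Matrix {x // x ∈ J} {x // x ∈ J} (ZMod 2) :=
  Matrix.of fun i j => if G.Adj i.1 j.1 then 1 else 0

/-- The deframed rank polynomial
`R̂(G)(X) = Σ_{J ⊆ V} (−1)^{n−|J|} X^{rank(G_J)} ∈ ℤ[X]`. -/
noncomputable def Rhat {V : Type*} [Fintype V] [DecidableEq V] (G : SimpleGraph V) :
    Polynomial ℤ :=
  ∑ J : Finset V, (-1 : Polynomial ℤ) ^ (Fintype.card V - J.card) *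
    Polynomial.X ^ (inducedAdj G J).rank

/-- Adding an isolated vertex to `J` does not change the rank of the induced adjacency matrix. -/
theorem rank_inducedAdj_insert {V : Type*} [DecidableEq V] (G : SimpleGraph V) {v : V}
    (hv : ∀ w, ¬ G.Adj v w) (J : Finset V) :
    (inducedAdj G (insert v J)).rank = (inducedAdj G J).rank := by
  have hv' : ∀ w, ¬ G.Adj w v := fun w h => hv w h.symm
  let P : Matrix {x // x ∈ insert v J} {x // x ∈ J} (ZMod 2) :=
    Matrix.of fun i j => if i.1 = j.1 then 1 else 0
  have sum_eq_dite : ∀ (K : Finset V) (a : V) (f : {x // x ∈ K} → ZMod 2),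
      ∑ k, (if a = k.1 then f k else 0) = if h : a ∈ K then f ⟨a, h⟩ else 0 := by
    intro K a f
    split_ifs with h
    · rw [Finset.sum_eq_single ⟨a, h⟩]
      · simp
      · intro b _ hb
        exact if_neg fun e => hb (Subtype.ext e.symm)
      · simp
    · exact Finset.sum_eq_zero fun k _ => if_neg fun e : a = k.1 => h (e ▸ k.2)
  have restrict : inducedAdj G J = Pᵀ * (inducedAdj G (insert v J) * P) := by
    ext ⟨i, hi⟩ ⟨j, hj⟩
    simp only [Matrix.mul_apply, Matrix.transpose_apply, P, Matrix.of_apply, ite_mul, mul_ite,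
      one_mul, zero_mul, mul_one, mul_zero, eq_comm (b := i), eq_comm (b := j), sum_eq_dite]
    simp [hi, hj, inducedAdj]
  have extend : inducedAdj G (insert v J) = P * (inducedAdj G J * Pᵀ) := by
    ext ⟨i, hi⟩ ⟨j, hj⟩
    simp only [Matrix.mul_apply, Matrix.transpose_apply, P, Matrix.of_apply, ite_mul, mul_ite,
      one_mul, zero_mul, mul_one, mul_zero, sum_eq_dite]
    rcases Finset.mem_insert.mp hi with rfl | hi' <;>
      rcases Finset.mem_insert.mp hj with rfl | hj' <;>
      simp_all [inducedAdj]
  apply le_antisymm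
  · rw [extend]
    exact (Matrix.rank_mul_le_right _ _).trans (Matrix.rank_mul_le_left _ _)
  · conv_lhs => rw [restrict]
    exact (Matrix.rank_mul_le_right _ _).trans (Matrix.rank_mul_le_left _ _)

/-- If `G` has an isolated vertex, then `R̂(G)` is the zero polynomial. -/
theorem Rhat_eq_zero_of_isolated {V : Type*} [Fintype V] [DecidableEq V]
    (G : SimpleGraph V) (v : V) (hv : ∀ w, ¬ G.Adj v w) :
    Rhat G = 0 := by
  have huniv : (Finset.univ : Finset (Finset V)) =
      (insert v (Finset.univ.erase v)).powerset := by
    rw [Finset.insert_erase (Finset.mem_univ v), Finset.powerset_univ]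
  rw [Rhat, huniv, Finset.sum_powerset_insert (Finset.notMem_erase v _),
    ← Finset.sum_add_distrib]
  refine Finset.sum_eq_zero fun J hJ => ?_
  have hvJ : v ∉ J := fun h => Finset.notMem_erase v _ (Finset.mem_powerset.mp hJ h)
  have hcard : (insert v J).card ≤ Fintype.card V := Finset.card_le_univ _
  rw [Finset.card_insert_of_notMem hvJ] at hcard
  rw [rank_inducedAdj_insert G hv, Finset.card_insert_of_notMem hvJ,
    show Fintype.card V - J.card = Fintype.card V - (J.card + 1) + 1 by omega, pow_succ]
  ring
end

section
/- Let k ≥ 1 and let σ be a fixed-point-free involution of ZMod (2k) (a chord diagram of degree k). Then the determinant over ℤ/2ℤ of the adjacency matrix of the intersection graph Γ(σ) equals 1 if and only if the permutation of ZMod (2k) given by i ↦ σ(i + 1) has exactly one orbit. (This is the Conway weight system: the determinant of the intersection graph is 1 precisely when surgery on all chords yields a single circle, and 0 otherwise.) -/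
open Matrix

/-- The type of chords of the chord diagram given by a fixed-point-free
involution `σ` of `ZMod (2k)`: each chord is represented by its endpoint with
the smaller representative in `{0, 1, …, 2k−1}`. -/
abbrev Chord (k : ℕ) (σ : Equiv.Perm (ZMod (2 * k))) : Type :=
  {i : ZMod (2 * k) // i.val < (σ i).val}

/-- Two chords `{a, σ a}` and `{c, σ c}` (with `a.val < (σ a).val` and
`c.val < (σ c).val`) interlace iff exactly one of `c`, `σ c` lies strictly
between `a` and `σ a`. -/
def Interlace (k : ℕ) (σ : Equiv.Perm (ZMod (2 * k))) (a c : ZMod (2 * k)) : Prop :=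
  Xor' (a.val < c.val ∧ c.val < (σ a).val) (a.val < (σ c).val ∧ (σ c).val < (σ a).val)

open Classical in
/-- The adjacency matrix over `ℤ/2ℤ` of the intersection graph `Γ(σ)` of the
chord diagram `σ`: two distinct chords are adjacent iff they interlace. -/
noncomputable def interMat (k : ℕ) (σ : Equiv.Perm (ZMod (2 * k))) :
    Matrix (Chord k σ) (Chord k σ) (ZMod 2) :=
  Matrix.of fun a c => if a ≠ c ∧ Interlace k σ a.1 c.1 then 1 else 0

/-- The setoid on `α` whose classes are the orbits of the permutation `τ`. -/
def cycleSetoid {α : Type*} (τ : Equiv.Perm α) : Setoid α where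
  r := τ.SameCycle
  iseqv := ⟨fun x => Equiv.Perm.SameCycle.refl τ x,
    fun h => h.symm, fun h h' => h.trans h'⟩

/-- In `ZMod 2`, the indicator of an exclusive or is the sum of the indicators. -/
theorem ite_xor_eq_add (p q : Prop) [Decidable p] [Decidable q] [Decidable (Xor p q)] :
    (if Xor p q then (1 : ZMod 2) else 0) = (if p then 1 else 0) + (if q then 1 else 0) := by
  by_cases hp : p <;> by_cases hq : q <;> simp [Xor, hp, hq]
  decide

/-- A sum over `ZMod n` is a sum over the representatives `0, …, n - 1`. -/
theorem sum_zmod_eq_sum_range {M : Type*} [AddCommMonoid M] (n : ℕ) [NeZero n] (g : ZMod n → M) :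
    ∑ j, g j = ∑ m ∈ Finset.range n, g m := by
  refine Finset.sum_bij' (fun j _ => j.val) (fun m _ => (m : ZMod n)) ?_ ?_ ?_ ?_ ?_
  · intro j _
    simpa using ZMod.val_lt j
  · simp
  · simp
  · intro m hm
    exact ZMod.val_cast_of_lt (Finset.mem_range.mp hm)
  · simp

/-- Summing the cyclic differences of `f` over the points strictly between `a` and `b`
telescopes. -/
theorem sum_between_sub {M : Type*} [AddCommGroup M] (n : ℕ) [NeZero n] (f : ZMod n → M)
    {a b : ZMod n} (hab : a.val < b.val) :
    (∑ j : ZMod n, if a.val < j.val ∧ j.val < b.val then f j - f (j - 1) else 0)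
      = f (b - 1) - f a := by
  have hb := ZMod.val_lt b
  rw [sum_zmod_eq_sum_range]
  have hIco : ∀ m ∈ Finset.range n,
      (if a.val < (m : ZMod n).val ∧ (m : ZMod n).val < b.val
        then f m - f ((m : ZMod n) - 1) else 0)
      = if m ∈ Finset.Ico (a.val + 1) b.val
        then f (((m + 1 : ℕ) : ZMod n) - 1) - f ((m : ZMod n) - 1) else 0 := by
    intro m hm
    rw [ZMod.val_cast_of_lt (Finset.mem_range.mp hm)]
    simp
  rw [Finset.sum_congr rfl hIco, Finset.sum_ite_mem, Finset.inter_eq_right.mpr ?_,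
    Finset.sum_Ico_sub (fun m : ℕ => f ((m : ZMod n) - 1)) (by omega)]
  · simp
  · intro m hm
    simp only [Finset.mem_Ico, Finset.mem_range] at *
    omega

/-- A function on `ZMod n` with vanishing cyclic differences is constant. -/
theorem eq_of_forall_eq_sub_one {α : Type*} (n : ℕ) [NeZero n] (f : ZMod n → α)
    (h : ∀ i, f i = f (i - 1)) (i j : ZMod n) : f i = f j := by
  have hcast : ∀ m : ℕ, f (m : ZMod n) = f 0 := by
    intro m
    induction m with
    | zero => simp
    | succ m ih => rw [h, ← ih]; simp
  rw [← ZMod.natCast_zmod_val i, ← ZMod.natCast_zmod_val j, hcast, hcast]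

/-- A function on `ZMod n` with total sum zero is a cyclic difference. -/
theorem exists_sub_eq_of_sum_eq_zero {M : Type*} [AddCommGroup M] (n : ℕ) [NeZero n]
    (y : ZMod n → M) (hy : ∑ j, y j = 0) : ∃ f : ZMod n → M, ∀ i, f i - f (i - 1) = y i := by
  refine ⟨fun i => ∑ m ∈ Finset.range (i.val + 1), y m, fun i => ?_⟩
  obtain ⟨j, rfl⟩ : ∃ j, i = j + 1 := ⟨i - 1, by simp⟩
  have hj := ZMod.val_lt j
  simp only [add_sub_cancel_right]
  have hcast : ((j.val + 1 : ℕ) : ZMod n) = j + 1 := by simp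
  rcases Nat.lt_or_ge (j.val + 1) n with h | h
  · have hv : (j + 1).val = j.val + 1 := by
      rw [← hcast, ZMod.val_cast_of_lt h]
    rw [hv, Finset.sum_range_succ _ (j.val + 1), hcast, add_sub_cancel_left]
  · have hn : j.val + 1 = n := by omega
    have hj0 : j + 1 = 0 := by rw [← hcast, hn, ZMod.natCast_self]
    rw [hn, ← sum_zmod_eq_sum_range, hy, hj0]
    simp

section ChordDiagram

variable {k : ℕ} {σ : Equiv.Perm (ZMod (2 * k))}

/-- A function taking equal values before and after every chord endpoint, as prescribed by the
boundary permutation, has `σ`-invariant cyclic differences. -/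
theorem sub_comp_eq_of_invariant (hinv : ∀ i, σ (σ i) = i) {f : ZMod (2 * k) → ZMod 2}
    (hf : ∀ i, f (σ i - 1) = f i) (i : ZMod (2 * k)) :
    f (σ i) - f (σ i - 1) = f i - f (i - 1) := by
  have h := hf (σ i)
  rw [hinv] at h
  rw [hf, ← h, ← neg_sub, ZMod.neg_eq_self_mod_two]

/-- The defining condition of `Interlace`. -/
theorem interlace_iff_xor (a c : ZMod (2 * k)) : Interlace k σ a c ↔
    Xor (a.val < c.val ∧ c.val < (σ a).val) (a.val < (σ c).val ∧ (σ c).val < (σ a).val) :=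
  Iff.rfl

variable [NeZero (2 * k)]

/-- A sum over all points is a sum over chords of the contributions of both endpoints. -/
theorem sum_eq_sum_chord {M : Type*} [AddCommMonoid M]
    (hinv : ∀ i, σ (σ i) = i) (hfix : ∀ i, σ i ≠ i) (g : ZMod (2 * k) → M) :
    ∑ j, g j = ∑ c : Chord k σ, (g c + g (σ c)) := by
  classical
  rw [Finset.sum_add_distrib,
    ← Finset.sum_filter_add_sum_filter_not Finset.univ (fun j => j.val < (σ j).val)]
  congr 1
  · exact Finset.sum_subtype _ (by simp) g
  · refine Eq.trans ?_ (Finset.sum_subtype (Finset.univ.filter fun j => j.val < (σ j).val)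
      (by simp) (fun j => g (σ j)))
    refine Finset.sum_bij' (fun j _ => σ j) (fun j _ => σ j) ?_ ?_ ?_ ?_ ?_
    · intro j hj
      have hne : (σ j).val ≠ j.val := fun h => hfix j (ZMod.val_injective _ h)
      simp only [Finset.mem_filter, Finset.mem_univ, true_and, hinv, not_lt] at hj ⊢
      omega
    · intro j hj
      simp only [Finset.mem_filter, Finset.mem_univ, true_and, hinv] at hj ⊢
      exact hj.not_gt
    all_goals simp [hinv]

/-- If `f` has `σ`-invariant cyclic differences, the adjacency matrix sends these, viewed as a
vector indexed by chords, to the differences of `f` across the chords. -/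
theorem interMat_mulVec (hinv : ∀ i, σ (σ i) = i) (hfix : ∀ i, σ i ≠ i)
    (f : ZMod (2 * k) → ZMod 2) (hf : ∀ i, f (σ i) - f (σ i - 1) = f i - f (i - 1))
    (a : Chord k σ) :
    (interMat k σ *ᵥ fun c => f c - f (c - 1)) a = f (σ a - 1) - f a := by
  classical
  rw [← sum_between_sub _ f a.2, sum_eq_sum_chord hinv hfix]
  refine Finset.sum_congr rfl fun c _ => ?_
  have hne : (a ≠ c ∧ Interlace k σ a.1 c.1) ↔ Interlace k σ a.1 c.1 := by
    refine and_iff_right_of_imp ?_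
    rintro h rfl
    simp [interlace_iff_xor] at h
  simp only [interMat, Matrix.of_apply, hne]
  simp only [interlace_iff_xor, ite_xor_eq_add, add_mul, ite_mul, one_mul, zero_mul, hf]

/-- The kernel of the adjacency matrix is trivial iff every function invariant under the boundary
permutation is constant. -/
theorem det_interMat_ne_zero_iff (hinv : ∀ i, σ (σ i) = i) (hfix : ∀ i, σ i ≠ i) :
    (interMat k σ).det ≠ 0 ↔
      ∀ f : ZMod (2 * k) → ZMod 2, (∀ i, f (σ i - 1) = f i) → ∀ i j, f i = f j := by
  classical
  rw [Ne, ← Matrix.exists_mulVec_eq_zero_iff]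
  constructor
  · intro h f hf
    have hs := sub_comp_eq_of_invariant hinv hf
    by_contra hc
    refine h ⟨fun c => f c - f (c - 1), fun h0 => hc ?_, ?_⟩
    · refine eq_of_forall_eq_sub_one _ f fun i => ?_
      rcases lt_or_gt_of_ne (fun h => hfix i (ZMod.val_injective _ h)) with hi | hi
      · have := congrFun h0 ⟨σ i, by rwa [hinv]⟩
        exact sub_eq_zero.mp ((hs i).symm.trans this)
      · exact sub_eq_zero.mp (congrFun h0 ⟨i, hi⟩)
    · ext a
      rw [interMat_mulVec hinv hfix f hs, hf, sub_self, Pi.zero_apply]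
  · rintro h ⟨x, hx, hAx⟩
    let y : ZMod (2 * k) → ZMod 2 := fun i =>
      if h : i.val < (σ i).val then x ⟨i, h⟩
      else if h : (σ i).val < (σ (σ i)).val then x ⟨σ i, h⟩ else 0
    have hyc : ∀ c : Chord k σ, y c = x c := fun c => dif_pos c.2
    have hyσc : ∀ c : Chord k σ, y (σ c) = x c := by
      intro c
      have h1 : ¬ (σ c).val < (σ (σ c)).val := by rw [hinv]; exact c.2.not_gt
      simp only [y, dif_neg h1, hinv, dif_pos c.2]
    have hyσ : ∀ i, y (σ i) = y i := by
      intro i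
      rcases lt_or_gt_of_ne (fun h => hfix i (ZMod.val_injective _ h)) with hi | hi
      · have hc := hyσc ⟨σ i, by rwa [hinv]⟩
        have hc' := hyc ⟨σ i, by rwa [hinv]⟩
        simp only [hinv] at hc hc'
        rw [hc, hc']
      · rw [hyσc ⟨i, hi⟩, hyc ⟨i, hi⟩]
    have hsum : ∑ j, y j = 0 := by
      rw [sum_eq_sum_chord hinv hfix]
      exact Finset.sum_eq_zero fun c _ => by rw [hyσ, CharTwo.add_self_eq_zero]
    obtain ⟨f, hf⟩ := exists_sub_eq_of_sum_eq_zero _ y hsum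
    have hs : ∀ i, f (σ i) - f (σ i - 1) = f i - f (i - 1) := fun i => by rw [hf, hf, hyσ]
    have hxf : x = fun c : Chord k σ => f c - f (c - 1) := by
      ext c
      rw [hf, hyc]
    have hchord : ∀ c : Chord k σ, f (σ c - 1) = f c := by
      intro c
      have := congrFun hAx c
      rw [hxf, interMat_mulVec hinv hfix f hs] at this
      exact sub_eq_zero.mp this
    have hconst := h f fun i => by
      rcases lt_or_gt_of_ne (fun h => hfix i (ZMod.val_injective _ h)) with hi | hi
      · have h1 := hchord ⟨σ i, by rwa [hinv]⟩
        have h2 := hs i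
        simp only [hinv] at h1
        rw [← h1, ← neg_sub, ZMod.neg_eq_self_mod_two] at h2
        exact sub_left_injective h2
      · exact hchord ⟨i, hi⟩
    refine hx ?_
    ext c
    rw [hxf]
    exact sub_eq_zero.mpr (hconst _ _)

end ChordDiagram

/-- A permutation has a single orbit iff every invariant two-valued function is constant. -/
theorem card_quotient_cycleSetoid_eq_one_iff {α : Type*} [Nonempty α] (τ : Equiv.Perm α) :
    Nat.card (Quotient (cycleSetoid τ)) = 1 ↔
      ∀ f : α → ZMod 2, (∀ i, f (τ i) = f i) → ∀ i j, f i = f j := by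
  classical
  have hne : Nonempty (Quotient (cycleSetoid τ)) := ‹Nonempty α›.map (Quotient.mk _)
  rw [Nat.card_eq_one_iff_unique, and_iff_left hne]
  constructor
  · intro hs f hf i j
    obtain ⟨m, rfl⟩ : τ.SameCycle i j := Quotient.exact (hs.elim ⟦i⟧ ⟦j⟧)
    have hinv : ∀ i, f (τ⁻¹ i) = f i := fun i => by rw [← hf (τ⁻¹ i), ← Equiv.Perm.mul_apply, mul_inv_cancel, Equiv.Perm.one_apply]
    induction m with
    | zero => simp
    | succ m ih => rw [add_comm, _root_.zpow_add, zpow_one, Equiv.Perm.mul_apply, hf, ih]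
    | pred m ih =>
      rw [sub_eq_add_neg, add_comm, _root_.zpow_add, _root_.zpow_neg_one,
        Equiv.Perm.mul_apply, hinv, ih]
  · refine fun h => ⟨fun p q => Quotient.inductionOn₂ p q fun i j => Quotient.sound ?_⟩
    have := h (fun l => if τ.SameCycle i l then 1 else 0) (by simp) i j
    by_contra hij
    change ¬ τ.SameCycle i j at hij
    simp [hij, Equiv.Perm.SameCycle.refl] at this

/-- For a chord diagram `σ` of degree `k ≥ 1` (a fixed-point-free involution of
`ZMod (2k)`), the determinant over `ℤ/2ℤ` of the adjacency matrix of the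
intersection graph `Γ(σ)` equals `1` iff the permutation `i ↦ σ (i + 1)` of
`ZMod (2k)` has exactly one orbit. -/
theorem det_interMat_eq_one_iff (k : ℕ) (hk : 1 ≤ k) [NeZero (2 * k)]
    (σ : Equiv.Perm (ZMod (2 * k)))
    (hinv : ∀ i, σ (σ i) = i) (hfix : ∀ i, σ i ≠ i) :
    (interMat k σ).det = 1 ↔
      Nat.card (Quotient (cycleSetoid
        ((Equiv.addRight (1 : ZMod (2 * k))).trans σ))) = 1 := by
  have hbit : ∀ d : ZMod 2, d = 1 ↔ d ≠ 0 := by decide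
  rw [hbit, det_interMat_ne_zero_iff hinv hfix, card_quotient_cycleSetoid_eq_one_iff]
  refine forall_congr' fun f => imp_congr_left ?_
  constructor
  · intro h i
    have := h (σ (i + 1))
    rw [hinv, add_sub_cancel_right] at this
    exact this.symm
  · intro h i
    have := h (σ i - 1)
    simp only [Equiv.trans_apply, Equiv.coe_addRight, sub_add_cancel, hinv] at this
    exact this.symm
end

section
/- Let (G, m) be a marked graph on a finite vertex type V and let A, B be distinct vertices. Then the rank over ℤ/2ℤ of the adjacency matrix of (G, m) equals the rank over ℤ/2ℤ of the adjacency matrix of the marked graph obtained from (G, m) by the marked move at (A, B), and likewise the determinants over ℤ/2ℤ of these two adjacency matrices are equal. -/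
open Matrix

open Classical in
/-- The adjacency matrix over `ℤ/2ℤ` of the marked graph `(G, m)`: off-diagonal
entry `(i,j)` is `1` iff `i` and `j` are adjacent, and diagonal entry `(i,i)` is
`1` iff `i` is marked (i.e. `i ∈ m`). -/
noncomputable def markedAdj {V : Type*} (G : SimpleGraph V) (m : Set V) :
    Matrix V V (ZMod 2) :=
  Matrix.of fun i j =>
    if i = j then (if i ∈ m then 1 else 0) else (if G.Adj i j then 1 else 0)

/-- The underlying graph of the marked graph obtained from `(G, m)` by the marked
move at `(A, B)`: toggle the edge `{A, C}` for every `C ∉ {A, B}` adjacent to `B`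
in `G`, and, if `B` is marked, also toggle the edge `{A, B}`. -/
def moveGraph {V : Type*} (G : SimpleGraph V) (m : Set V) (A B : V) : SimpleGraph V :=
  SimpleGraph.fromEdgeSet (symmDiff G.edgeSet
    {e | (∃ C, C ≠ A ∧ C ≠ B ∧ G.Adj B C ∧ e = s(A, C)) ∨ (B ∈ m ∧ e = s(A, B))})

/-- The marking of the marked graph obtained from `(G, m)` by the marked move at
`(A, B)`: if `B` is marked then the marking of `A` is toggled (so `A` is marked
iff exactly one of `A`, `B` is marked in `m`); all other markings are unchanged. -/
def moveMark {V : Type*} (m : Set V) (A B : V) : Set V :=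
  {x | (x = A ∧ Xor' (A ∈ m) (B ∈ m)) ∨ (x ≠ A ∧ x ∈ m)}

open Classical in
theorem markedAdj_apply_self {V : Type*} (G : SimpleGraph V) (m : Set V) (i : V) :
    markedAdj G m i i = if i ∈ m then 1 else 0 := by
  simp [markedAdj]

open Classical in
theorem markedAdj_apply_of_ne {V : Type*} (G : SimpleGraph V) (m : Set V) {i j : V}
    (h : i ≠ j) : markedAdj G m i j = if G.Adj i j then 1 else 0 := by
  simp [markedAdj, h]

theorem markedAdj_comm {V : Type*} (G : SimpleGraph V) (m : Set V) (i j : V) :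
    markedAdj G m i j = markedAdj G m j i := by
  classical
  rcases eq_or_ne i j with rfl | h
  · rfl
  · rw [markedAdj_apply_of_ne G m h, markedAdj_apply_of_ne G m h.symm]
    exact if_congr (G.adj_comm i j) rfl rfl

theorem moveGraph_adj_of_ne {V : Type*} (G : SimpleGraph V) (m : Set V) (A B : V) {i j : V}
    (hi : i ≠ A) (hj : j ≠ A) : (moveGraph G m A B).Adj i j ↔ G.Adj i j := by
  have := G.ne_of_adj (a := i) (b := j)
  simp only [moveGraph, SimpleGraph.fromEdgeSet_adj, Set.mem_symmDiff, SimpleGraph.mem_edgeSet,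
    Set.mem_ofPred_eq, Sym2.eq_iff]
  grind

open Classical in
theorem moveGraph_adj_left {V : Type*} (G : SimpleGraph V) (m : Set V) {A B j : V}
    (hAB : A ≠ B) (hj : j ≠ A) :
    (moveGraph G m A B).Adj A j ↔ Xor (G.Adj A j) (if j = B then B ∈ m else G.Adj B j) := by
  simp only [moveGraph, SimpleGraph.fromEdgeSet_adj, Set.mem_symmDiff, SimpleGraph.mem_edgeSet,
    Set.mem_ofPred_eq, Sym2.eq_iff, Xor]
  grind

theorem markedAdj_move_apply_left {V : Type*} (G : SimpleGraph V) (m : Set V) {A B j : V}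
    (hAB : A ≠ B) (hj : j ≠ A) :
    markedAdj (moveGraph G m A B) (moveMark m A B) A j =
      markedAdj G m A j + markedAdj G m B j := by
  classical
  rw [markedAdj_apply_of_ne _ _ hj.symm, markedAdj_apply_of_ne _ _ hj.symm,
    if_congr (moveGraph_adj_left G m hAB hj) rfl rfl]
  have h2 : (1 : ZMod 2) + 1 = 0 := by decide
  rcases eq_or_ne j B with rfl | hB
  · rw [markedAdj_apply_self]
    by_cases h₁ : G.Adj A j <;> by_cases h₂ : j ∈ m <;> simp [h₁, h₂, h2, Xor]
  · rw [markedAdj_apply_of_ne _ _ hB.symm]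
    by_cases h₁ : G.Adj A j <;> by_cases h₂ : G.Adj B j <;> simp [h₁, h₂, hB, h2, Xor]

theorem markedAdj_move_apply_of_ne {V : Type*} (G : SimpleGraph V) (m : Set V) (A B : V)
    {i j : V} (hi : i ≠ A) (hj : j ≠ A) :
    markedAdj (moveGraph G m A B) (moveMark m A B) i j = markedAdj G m i j := by
  classical
  rcases eq_or_ne i j with rfl | h
  · by_cases h : i ∈ m <;> simp [markedAdj_apply_self, moveMark, hi, h]
  · rw [markedAdj_apply_of_ne _ _ h, markedAdj_apply_of_ne _ _ h]
    exact if_congr (moveGraph_adj_of_ne G m A B hi hj) rfl rfl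

theorem markedAdj_move_apply_self {V : Type*} (G : SimpleGraph V) (m : Set V) (A B : V) :
    markedAdj (moveGraph G m A B) (moveMark m A B) A A =
      markedAdj G m A A + markedAdj G m B B := by
  have h2 : (1 : ZMod 2) + 1 = 0 := by decide
  by_cases h₁ : A ∈ m <;> by_cases h₂ : B ∈ m <;>
    simp [markedAdj_apply_self, moveMark, h₁, h₂, h2, Xor', Xor]

/-- The marked move at `(A, B)` acts on the adjacency matrix by congruence: it adds row `B` to
row `A` and column `B` to column `A`. -/
theorem markedAdj_move {V : Type*} [Fintype V] [DecidableEq V]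
    (G : SimpleGraph V) (m : Set V) {A B : V} (hAB : A ≠ B) :
    markedAdj (moveGraph G m A B) (moveMark m A B) =
      transvection A B 1 * markedAdj G m * transvection B A 1 := by
  ext i j
  rcases eq_or_ne j A with rfl | hj
  · rw [mul_transvection_apply_same, one_mul]
    rcases eq_or_ne i j with rfl | hi
    · rw [transvection_mul_apply_same, transvection_mul_apply_same, one_mul, one_mul,
        markedAdj_move_apply_self, markedAdj_comm G m B i]
      linear_combination -(CharTwo.add_self_eq_zero (markedAdj G m i B))
    · rw [transvection_mul_apply_of_ne _ _ _ _ hi, transvection_mul_apply_of_ne _ _ _ _ hi,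
        markedAdj_comm, markedAdj_move_apply_left G m hAB hi, markedAdj_comm G m j,
        markedAdj_comm G m B]
  · rw [mul_transvection_apply_of_ne _ _ _ _ hj]
    rcases eq_or_ne i A with rfl | hi
    · rw [transvection_mul_apply_same, one_mul, markedAdj_move_apply_left G m hAB hj]
    · rw [transvection_mul_apply_of_ne _ _ _ _ hi, markedAdj_move_apply_of_ne G m A B hi hj]

/-- The rank and the determinant over `ℤ/2ℤ` of the adjacency matrix of a marked
graph `(G, m)` are unchanged by the marked move at `(A, B)`. -/
theorem rank_det_markedAdj_move {V : Type*} [Fintype V] [DecidableEq V]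
    (G : SimpleGraph V) (m : Set V) (A B : V) (hAB : A ≠ B) :
    (markedAdj G m).rank = (markedAdj (moveGraph G m A B) (moveMark m A B)).rank ∧
    (markedAdj G m).det = (markedAdj (moveGraph G m A B) (moveMark m A B)).det := by
  rw [markedAdj_move G m hAB]
  constructor
  · rw [rank_mul_eq_left_of_isUnit_det _ _ (by simp [det_transvection_of_ne _ _ hAB.symm]),
      rank_mul_eq_right_of_isUnit_det _ _ (by simp [det_transvection_of_ne _ _ hAB])]
  · simp [det_mul, det_transvection_of_ne _ _ hAB, det_transvection_of_ne _ _ hAB.symm]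
end

section
/- Let G be a finite simple graph on a finite vertex set V with n = |V|, and suppose G has an isolated vertex. Then the polynomial Ŝ(G)(X) = Σ_{J ⊆ V} (X − 1)^{n−|J|} S(G_J) = Σ_{J ⊆ V} Σ_{J_m ⊆ J} (−1)^{|J_m|} (X − 1)^{n−|J|} X^{rank(adj_{J_m}(G_J))} is the zero polynomial in ℤ[X]. -/
open Matrix Polynomial

open Classical in
/-- The adjacency matrix over `ℤ/2ℤ` of the marked graph `(G_J, J_m)`: the
induced subgraph of `G` on `J`, with the vertices in `J_m` marked. Off-diagonal
entries record adjacency in `G`, and the diagonal entry at a vertex is `1` iff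
that vertex lies in `J_m`. -/
noncomputable def inducedMarkedAdj {V : Type*} (G : SimpleGraph V) (J Jm : Finset V) :
    Matrix {x // x ∈ J} {x // x ∈ J} (ZMod 2) :=
  Matrix.of fun i j =>
    if (i : V) = (j : V) then (if (i : V) ∈ Jm then 1 else 0)
    else (if G.Adj i.1 j.1 then 1 else 0)

/-- The deframed polynomial
`Ŝ(G)(X) = Σ_{J ⊆ V} Σ_{J_m ⊆ J} (−1)^{|J_m|} (X − 1)^{n−|J|} X^{rank(adj_{J_m}(G_J))}`. -/
noncomputable def Shat {V : Type*} [Fintype V] [DecidableEq V] (G : SimpleGraph V) :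
    Polynomial ℤ :=
  ∑ J : Finset V, ∑ Jm ∈ J.powerset,
    (-1 : Polynomial ℤ) ^ Jm.card * (Polynomial.X - 1) ^ (Fintype.card V - J.card) *
      Polynomial.X ^ (inducedMarkedAdj G J Jm).rank

namespace Submodule

theorem finrank_prod {K M N : Type*} [Field K] [AddCommGroup M] [Module K M] [AddCommGroup N]
    [Module K N] [FiniteDimensional K M] [FiniteDimensional K N]
    (p : Submodule K M) (q : Submodule K N) :
    Module.finrank K (p.prod q) = Module.finrank K p + Module.finrank K q := by
  have hinj : Function.Injective (p.subtype.prodMap q.subtype) :=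
    p.injective_subtype.prodMap q.injective_subtype
  have hrange : (p.subtype.prodMap q.subtype).range = p.prod q := by
    rw [LinearMap.range_prodMap, range_subtype, range_subtype]
  rw [← hrange, LinearMap.finrank_range_of_inj hinj, Module.finrank_prod]

end Submodule

namespace Matrix

theorem rank_fromBlocks_zero_zero {K l m n o : Type*} [Field K] [Fintype l] [Fintype m]
    [Fintype n] [Fintype o] (A : Matrix n l K) (D : Matrix o m K) :
    (fromBlocks A 0 0 D).rank = A.rank + D.rank := by
  have hfactor : (fromBlocks A 0 0 D).mulVecLin =
      (LinearEquiv.sumArrowLequivProdArrow n o K K).symm.toLinearMap ∘ₗ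
        (A.mulVecLin.prodMap D.mulVecLin) ∘ₗ
          (LinearEquiv.sumArrowLequivProdArrow l m K K).toLinearMap := by
    refine LinearMap.ext fun x => ?_
    rw [mulVecLin_apply, fromBlocks_mulVec]
    ext (i | i) <;> simp <;> rfl
  rw [rank, hfactor, LinearMap.range_comp, LinearEquiv.finrank_map_eq,
    LinearEquiv.range_comp, LinearMap.range_prodMap, Submodule.finrank_prod, rank, rank]

end Matrix

theorem rank_inducedMarkedAdj_insert {V : Type*} [DecidableEq V] (G : SimpleGraph V) {v : V}
    (hv : ∀ w, ¬ G.Adj v w) {J : Finset V} (hJ : v ∉ J) (Jm : Finset V) :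
    (inducedMarkedAdj G (insert v J) Jm).rank =
      (inducedMarkedAdj G J Jm).rank + if v ∈ Jm then 1 else 0 := by
  have hv' : ∀ w, ¬ G.Adj w v := fun w h => hv w h.symm
  let e := (Finset.subtypeInsertEquivOption hJ).trans (Equiv.optionEquivSumPUnit.{0} _)
  have hblocks : (inducedMarkedAdj G (insert v J) Jm).submatrix e.symm e.symm =
      fromBlocks (inducedMarkedAdj G J Jm) 0 0
        (diagonal fun _ => if v ∈ Jm then 1 else 0) := by
    have hne : ∀ w : {x // x ∈ J}, (w : V) ≠ v := fun w h => hJ (h ▸ w.2)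
    ext (i | i) (j | j) <;>
      simp [e, inducedMarkedAdj, Finset.subtypeInsertEquivOption, hv, hv', hne, (hne _).symm]
  rw [← rank_submatrix _ e.symm e.symm, hblocks, rank_fromBlocks_zero_zero, rank_diagonal]
  split_ifs <;> simp

theorem inducedMarkedAdj_insert_marked {V : Type*} [DecidableEq V] (G : SimpleGraph V) {v : V}
    {J : Finset V} (hJ : v ∉ J) (Jm : Finset V) :
    inducedMarkedAdj G J (insert v Jm) = inducedMarkedAdj G J Jm := by
  have hne : ∀ w : {x // x ∈ J}, (w : V) ≠ v := fun w h => hJ (h ▸ w.2)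
  ext i j
  simp only [inducedMarkedAdj, of_apply, Finset.mem_insert, hne, false_or]
  congr

/-- If `G` has an isolated vertex, then `Ŝ(G)` is the zero polynomial. -/
theorem Shat_eq_zero_of_isolated {V : Type*} [Fintype V] [DecidableEq V]
    (G : SimpleGraph V) (v : V) (hv : ∀ w, ¬ G.Adj v w) :
    Shat G = 0 := by
  have huniv : (Finset.univ : Finset (Finset V)) =
      (insert v (Finset.univ.erase v)).powerset := by
    rw [Finset.insert_erase (Finset.mem_univ v), Finset.powerset_univ]
  rw [Shat, huniv, Finset.sum_powerset_insert (Finset.notMem_erase v _),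
    ← Finset.sum_add_distrib]
  refine Finset.sum_eq_zero fun J hJ => ?_
  have hvJ : v ∉ J := fun h => Finset.notMem_erase v _ (Finset.mem_powerset.mp hJ h)
  rw [Finset.sum_powerset_insert hvJ, ← Finset.sum_add_distrib, ← Finset.sum_add_distrib]
  refine Finset.sum_eq_zero fun Jm hJm => ?_
  have hvJm : v ∉ Jm := fun h => hvJ (Finset.mem_powerset.mp hJm h)
  have hcard : Fintype.card V - J.card = Fintype.card V - (J.card + 1) + 1 := by
    have := Finset.card_le_univ (insert v J)
    rw [Finset.card_insert_of_notMem hvJ] at this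
    omega
  rw [rank_inducedMarkedAdj_insert G hv hvJ, rank_inducedMarkedAdj_insert G hv hvJ,
    inducedMarkedAdj_insert_marked G hvJ, if_neg hvJm, if_pos (Finset.mem_insert_self v Jm),
    Finset.card_insert_of_notMem hvJ, Finset.card_insert_of_notMem hvJm, hcard]
  ring
end
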